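/- arXiv:1306.0828 — 3 statements merged into one kernel-verified Lean document; each statement's English description precedes it below -/
import Mathlib

section
/- Let R be a commutative ring and let φ be as in the context. Then the ideal ker φ ⊆ R[Y] is generated by the binomials it contains of total degree at most 2·max_{p∈[N]} k_p − 1, where a binomial is a difference u − v of two monomials in the variables y_{p,J}. -/
open MvPolynomial

/-- The index set of the variables `y_{p,J}`, `p ∈ [N]`, `J : [k_p] → ℕ` injective. -/
def YIdx (N : ℕ) (k : Fin N → ℕ) : Type :=
  Σ p : Fin N, {J : Fin (k p) → ℕ // Function.Injective J}

/-- The index set of the variables `x_{p,l,j}`, `p ∈ [N]`, `l ∈ [k_p]`, `j ∈ ℕ`. -/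
def XIdxM (N : ℕ) (k : Fin N → ℕ) : Type := Σ p : Fin N, Fin (k p) × ℕ

/-- The monomial map `φ : R[Y] → R[X]`, `y_{p,J} ↦ ∏_{l ∈ [k_p]} x_{p,l,J(l)}`. -/
noncomputable def matchingPhi (R : Type) [CommRing R] (N : ℕ) (k : Fin N → ℕ) :
    MvPolynomial (YIdx N k) R →ₐ[R] MvPolynomial (XIdxM N k) R :=
  aeval fun y : YIdx N k =>
    ∏ l : Fin (k y.1), (X (⟨y.1, (l, y.2.1 l)⟩ : XIdxM N k) : MvPolynomial (XIdxM N k) R)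

/-- A matrix of natural numbers with constant positive row sums `e` and column sums at most `e`
has a system of distinct column representatives supported on positive entries. -/
theorem exists_injective_pos_of_sum_eq {m n : Type*} [Fintype m] [Fintype n]
    (B : m → n → ℕ) {e : ℕ} (he : 0 < e) (hrow : ∀ i, ∑ j, B i j = e)
    (hcol : ∀ j, ∑ i, B i j ≤ e) :
    ∃ f : m → n, Function.Injective f ∧ ∀ i, 0 < B i (f i) := by
  classical
  obtain ⟨f, hf, hf'⟩ := (Finset.all_card_le_biUnion_card_iff_exists_injective
    (fun i => Finset.univ.filter fun j => 0 < B i j)).1 (by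
      intro S
      set T := S.biUnion fun i => Finset.univ.filter fun j => 0 < B i j with hT
      refine Nat.le_of_mul_le_mul_right ?_ he
      calc S.card * e = ∑ i ∈ S, ∑ j, B i j := by simp [hrow]
        _ = ∑ i ∈ S, ∑ j ∈ T, B i j := by
          refine Finset.sum_congr rfl fun i hi => ?_
          refine (Finset.sum_subset (Finset.subset_univ T) fun j _ hj => ?_).symm
          by_contra h
          exact hj (Finset.mem_biUnion.2 ⟨i, hi, by simpa using Nat.pos_of_ne_zero h⟩)
        _ = ∑ j ∈ T, ∑ i ∈ S, B i j := Finset.sum_comm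
        _ ≤ ∑ j ∈ T, e := Finset.sum_le_sum fun j _ =>
          (Finset.sum_le_sum_of_subset (Finset.subset_univ S)).trans (hcol j)
        _ = T.card * e := by simp)
  exact ⟨f, hf, fun i => by simpa using hf' i⟩

/-- An injective choice of representatives of multisets of equal size `e` that meets every element
of total multiplicity `e`. -/
theorem exists_injective_mem_hitting {ι α : Type*} [Fintype ι] [DecidableEq α]
    (A : ι → Multiset α) {e : ℕ} (he : 0 < e) (hrow : ∀ l, (A l).card = e)
    (hcol : ∀ j, ∑ l, (A l).count j ≤ e) :
    ∃ J : ι → α, Function.Injective J ∧ (∀ l, J l ∈ A l) ∧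
      ∀ j, ∑ l, (A l).count j = e → ∃ l, J l = j := by
  classical
  let C : Finset α := Finset.univ.biUnion fun l => (A l).toFinset
  have hC : ∀ l, ∑ c : C, (A l).count (c : α) = e := fun l => by
    rw [Finset.sum_coe_sort C fun c => (A l).count c, ← hrow l]
    exact Multiset.sum_count_eq_card fun a ha =>
      Finset.mem_biUnion.2 ⟨l, Finset.mem_univ _, by simpa using ha⟩
  let B : ι ⊕ C → C ⊕ ι → ℕ := fun i j => match i, j with
    | .inl l, .inl c => (A l).count (c : α)
    | .inl _, .inr _ => 0
    | .inr c', .inl c => if c' = c then e - ∑ l, (A l).count (c : α) else 0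
    | .inr c', .inr l => (A l).count (c' : α)
  obtain ⟨f, hf, hpos⟩ := exists_injective_pos_of_sum_eq B he
    (by
      rintro (l | c)
      · simpa [B, Fintype.sum_sum_type] using hC l
      · simpa [B, Fintype.sum_sum_type] using Nat.sub_add_cancel (hcol c))
    (by
      rintro (c | l)
      · have := hcol c
        simp only [B, Fintype.sum_sum_type, Finset.sum_ite_eq', Finset.mem_univ, if_true]
        omega
      · simpa [B, Fintype.sum_sum_type] using (hC l).le)
  have hsurj : Function.Surjective f :=
    ((Fintype.bijective_iff_injective_and_card f).2 ⟨hf, by simp [add_comm]⟩).2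
  have hinl : ∀ l, ∃ c : C, f (.inl l) = .inl c := fun l => by
    have h := hpos (.inl l)
    rcases hfl : f (.inl l) with c | l'
    · exact ⟨c, rfl⟩
    · simp [hfl, B] at h
  choose J hJ using hinl
  refine ⟨fun l => J l, fun l l' h => ?_, fun l => ?_, fun j hj => ?_⟩
  · have : f (.inl l) = f (.inl l') := by rw [hJ, hJ, Subtype.ext h]
    exact Sum.inl_injective (hf this)
  · have h := hpos (.inl l)
    rw [hJ] at h
    exact Multiset.count_pos.1 h
  · have hjC : j ∈ C := by
      obtain ⟨l, _, hl⟩ := Finset.exists_ne_zero_of_sum_ne_zero (hj.trans_ne he.ne')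
      exact Finset.mem_biUnion.2 ⟨l, Finset.mem_univ _, by
        simpa using Multiset.count_ne_zero.1 hl⟩
    obtain ⟨i, hi⟩ := hsurj (.inl ⟨j, hjC⟩)
    rcases i with l | c
    · refine ⟨l, ?_⟩
      rw [hJ] at hi
      exact congrArg Subtype.val (Sum.inl_injective hi)
    · have h := hpos (.inr c)
      simp [hi, B, hj] at h

/-- The number of occurrences of `j` in a multiset of injective maps, counted over all positions,
is the number of maps whose range contains `j`. -/
theorem sum_count_map_eq_countP {ι α : Type*} [Fintype ι] [DecidableEq α]
    (s : Multiset {J : ι → α // Function.Injective J}) (j : α)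
    [DecidablePred fun y : {J : ι → α // Function.Injective J} => ∃ l, y.1 l = j] :
    ∑ l, (s.map fun y => y.1 l).count j = s.countP fun y => ∃ l, y.1 l = j := by
  classical
  induction s using Multiset.induction_on with
  | empty => simp
  | cons y s ih =>
    simp only [Multiset.map_cons, Multiset.count_cons, Finset.sum_add_distrib, ih,
      Multiset.countP_cons]
    congr 1
    split_ifs with h
    · obtain ⟨l, rfl⟩ := h
      simp [y.2.eq_iff]
    · push Not at h
      exact Finset.sum_eq_zero fun l _ => if_neg (h l).symm

/-- König's edge colouring theorem: multisets of equal size `e` in which every element has total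
multiplicity at most `e` are the coordinate multisets of a multiset of injective maps. -/
theorem exists_multiset_injective_map_eq {ι α : Type*} [Fintype ι] [DecidableEq α] (e : ℕ) :
    ∀ A : ι → Multiset α, (∀ l, (A l).card = e) → (∀ j, ∑ l, (A l).count j ≤ e) →
      ∃ s : Multiset {J : ι → α // Function.Injective J}, ∀ l, (s.map fun y => y.1 l) = A l := by
  classical
  induction e with
  | zero =>
    intro A hrow _
    exact ⟨0, fun l => by simp [Multiset.card_eq_zero.1 (hrow l)]⟩
  | succ e ih =>
    intro A hrow hcol
    obtain ⟨J, hJ, hmem, hhit⟩ := exists_injective_mem_hitting A e.succ_pos hrow hcol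
    obtain ⟨s, hs⟩ := ih (fun l => (A l).erase (J l))
      (fun l => by rw [Multiset.card_erase_of_mem (hmem l), hrow, Nat.pred_succ])
      (fun j => by
        by_cases hj : ∃ l, J l = j
        · obtain ⟨l, rfl⟩ := hj
          have h := hcol (J l)
          have hlt : ∑ l', ((A l').erase (J l')).count (J l) < ∑ l', (A l').count (J l) := by
            refine Finset.sum_lt_sum
              (fun l' _ => Multiset.count_le_of_le _ (Multiset.erase_le _ _))
              ⟨l, Finset.mem_univ _, ?_⟩
            rw [Multiset.count_erase_self]
            have := Multiset.count_pos.2 (hmem l)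
            omega
          omega
        · have h := hcol j
          have hne : ∑ l, (A l).count j ≠ e + 1 := fun h => hj (hhit j h)
          have hle : ∑ l, ((A l).erase (J l)).count j ≤ ∑ l, (A l).count j :=
            Finset.sum_le_sum fun l _ => Multiset.count_le_of_le _ (Multiset.erase_le _ _)
          omega)
    exact ⟨⟨J, hJ⟩ ::ₘ s, fun l => by simp [hs, Multiset.cons_erase (hmem l)]⟩

/-- If each of the conditions `r a`, `a ∈ F`, fails for at most one member of `s`, and `s` has more
members than `F`, then some member of `s` satisfies all of them. -/
theorem exists_mem_forall_of_countP_not_le_one {α β : Type*} (r : α → β → Prop)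
    [∀ a, DecidablePred (r a)] (F : Finset α) :
    ∀ s : Multiset β, (∀ a ∈ F, s.countP (fun y => ¬ r a y) ≤ 1) → F.card < s.card →
      ∃ y ∈ s, ∀ a ∈ F, r a y := by
  classical
  induction F using Finset.induction_on with
  | empty =>
    intro s _ hs
    obtain ⟨y, hy⟩ := Multiset.card_pos_iff_exists_mem.1 (by simpa using hs)
    exact ⟨y, hy, by simp⟩
  | insert a F ha ih =>
    intro s hr hs
    rw [Finset.card_insert_of_notMem ha] at hs
    have hcard : s.card = s.countP (r a) + s.countP (fun y => ¬ r a y) :=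
      Multiset.card_eq_countP_add_countP _ _
    have h1 := hr a (Finset.mem_insert_self _ _)
    obtain ⟨y, hy, hyF⟩ := ih (s.filter (r a))
      (fun b hb => (Multiset.countP_le_of_le _ (Multiset.filter_le _ _)).trans
        (hr b (Finset.mem_insert_of_mem hb)))
      (by rw [← Multiset.countP_eq_card_filter]; omega)
    rw [Multiset.mem_filter] at hy
    exact ⟨y, hy.1, (Finset.forall_mem_insert ..).2 ⟨hy.2, hyF⟩⟩

/-- Two large multisets of injective maps with the same coordinate multisets are linked by a third
one sharing a member with each of them. -/
theorem exists_common_members {ι α : Type*} [Fintype ι] [Nonempty ι] [DecidableEq α]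
    (s t : Multiset {J : ι → α // Function.Injective J})
    (hst : ∀ l, (s.map fun y => y.1 l) = t.map fun y => y.1 l)
    (hcard : Fintype.card ι + 2 ≤ s.card) :
    ∃ y ∈ s, ∃ z ∈ t, ∃ w : Multiset {J : ι → α // Function.Injective J},
      ∀ l, ((y ::ₘ z ::ₘ w).map fun y => y.1 l) = s.map fun y => y.1 l := by
  classical
  obtain ⟨d, hd⟩ : ∃ d, s.card = d + 2 := ⟨s.card - 2, by omega⟩
  have htd : t.card = d + 2 := by
    have := congrArg Multiset.card (hst (Classical.arbitrary ι))
    simp only [Multiset.card_map] at this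
    omega
  set A : ι → Multiset α := fun l => s.map fun y => y.1 l with hA
  have hAcard : ∀ l, (A l).card = d + 2 := fun l => by simp [hA, hd]
  let hits (j : α) (y : {J : ι → α // Function.Injective J}) : Prop := ∃ l, y.1 l = j
  have hcols : ∀ j, ∑ l, (A l).count j = s.countP (hits j) := fun j => sum_count_map_eq_countP s j
  have hcolt : ∀ j, ∑ l, (A l).count j = t.countP (hits j) := fun j => by
    simp only [hA, hst]
    exact sum_count_map_eq_countP t j
  let C : Finset α := Finset.univ.biUnion fun l => (A l).toFinset
  let F : Finset α := C.filter fun j => d + 1 ≤ ∑ l, (A l).count j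
  have hF : F.card < s.card := by
    have h : F.card * (d + 1) ≤ Fintype.card ι * (d + 2) :=
      calc F.card * (d + 1) = ∑ j ∈ F, (d + 1) := by simp
        _ ≤ ∑ j ∈ F, ∑ l, (A l).count j :=
          Finset.sum_le_sum fun j hj => (Finset.mem_filter.1 hj).2
        _ ≤ ∑ j ∈ C, ∑ l, (A l).count j :=
          Finset.sum_le_sum_of_subset (Finset.filter_subset _ _)
        _ = ∑ l, ∑ j ∈ C, (A l).count j := Finset.sum_comm
        _ = ∑ l : ι, (d + 2) := by
          refine Finset.sum_congr rfl fun l _ => ?_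
          rw [← hAcard l]
          exact Multiset.sum_count_eq_card fun a ha =>
            Finset.mem_biUnion.2 ⟨l, Finset.mem_univ _, by simpa using ha⟩
        _ = Fintype.card ι * (d + 2) := by simp
    by_contra! hc
    rw [hd] at hc hcard
    nlinarith
  obtain ⟨y, hys, hyF⟩ := exists_mem_forall_of_countP_not_le_one hits F s (fun j hj => by
    have h1 : s.card = s.countP (hits j) + s.countP (fun y => ¬ hits j y) :=
      Multiset.card_eq_countP_add_countP _ _
    have h2 := (Finset.mem_filter.1 hj).2
    rw [hcols] at h2
    omega) hF
  obtain ⟨z, hzt, hz⟩ := exists_mem_forall_of_countP_not_le_one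
    (fun l (z : {J : ι → α // Function.Injective J}) =>
      ¬ (y.1 l = z.1 l ∧ (A l).count (y.1 l) ≤ 1)) Finset.univ t (fun l _ => by
    by_cases hl : (A l).count (y.1 l) ≤ 1
    · refine le_trans (le_of_eq ?_) hl
      simp only [hA, hst, Multiset.count_map]
      rw [Multiset.countP_eq_card_filter]
      refine congrArg _ (Multiset.filter_congr fun z _ => ?_)
      have : (t.map fun y => y.1 l).count (y.1 l) ≤ 1 := by rw [← hst]; exact hl
      simp only [Multiset.count_map] at this
      tauto
    · simp [hl]) (by rw [Finset.card_univ]; omega)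
  have hyA : ∀ l, y.1 l ∈ A l := fun l => Multiset.mem_map_of_mem _ hys
  have hzA : ∀ l, z.1 l ∈ (A l).erase (y.1 l) := fun l => by
    by_cases h : y.1 l = z.1 l
    · have := hz l (Finset.mem_univ _)
      rw [← h, ← Multiset.count_pos, Multiset.count_erase_self]
      have : ¬ (A l).count (y.1 l) ≤ 1 := fun h' => this ⟨h, h'⟩
      omega
    · rw [Multiset.mem_erase_of_ne (Ne.symm h)]
      simp only [hA, hst]
      exact Multiset.mem_map_of_mem _ hzt
  let A' : ι → Multiset α := fun l => ((A l).erase (y.1 l)).erase (z.1 l)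
  have hA' : ∀ l, A l = y.1 l ::ₘ z.1 l ::ₘ A' l := fun l => by
    rw [Multiset.cons_erase (hzA l), Multiset.cons_erase (hyA l)]
  have hsum : ∀ j, ∑ l, (A l).count j =
      ∑ l, (A' l).count j + (if hits j z then 1 else 0) + (if hits j y then 1 else 0) := fun j => by
    have e : ∀ w : {J : ι → α // Function.Injective J},
        ∑ l, (if j = w.1 l then 1 else 0) = if hits j w then 1 else 0 := fun w => by
      have := sum_count_map_eq_countP {w} j
      rw [← Multiset.cons_zero, Multiset.countP_cons, Multiset.countP_zero, zero_add] at this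
      simpa only [Multiset.map_cons, Multiset.map_zero, Multiset.count_cons, Multiset.count_zero,
        zero_add] using this
    simp only [hA', Multiset.count_cons, Finset.sum_add_distrib, e]
  obtain ⟨w, hw⟩ := exists_multiset_injective_map_eq d A'
    (fun l => by have := hAcard l; rw [hA'] at this; simpa using this)
    (fun j => by
      have h := hsum j
      have hle : ∑ l, (A l).count j ≤ d + 2 := by
        rw [hcols, ← hd]; exact Multiset.countP_le_card _ _
      have hy : d + 1 ≤ ∑ l, (A l).count j → hits j y := fun h' => hyF j
        (Finset.mem_filter.2 ⟨by
          obtain ⟨l, _, hl⟩ := Finset.exists_ne_zero_of_sum_ne_zero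
            (f := fun l => (A l).count j) (s := Finset.univ) (by omega)
          exact Finset.mem_biUnion.2 ⟨l, Finset.mem_univ _, by
            simpa using Multiset.count_ne_zero.1 hl⟩, h'⟩)
      have hz : ∑ l, (A l).count j = d + 2 → hits j z := fun h' =>
        Multiset.countP_eq_card.1 (by rw [← hcolt, h', htd]) z hzt
      split_ifs at h with h1 h2 h2
      · omega
      · have := mt hy h2
        omega
      · have := mt hz h1
        omega
      · have := mt hy h2
        omega)
  exact ⟨y, hys, z, hzt, w, fun l => by simp only [Multiset.map_cons, hw]; exact (hA' l).symm⟩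

/-- If a product over multisets of injective maps only depends on the coordinate multisets for
multisets of size at most `D`, where `D > |ι|`, then it does so for all multisets. -/
theorem prod_map_eq_of_bounded {ι α M : Type*} [Fintype ι] [Nonempty ι] [CommMonoid M]
    (f : {J : ι → α // Function.Injective J} → M) {D : ℕ} (hD : Fintype.card ι + 1 ≤ D)
    (hf : ∀ s t : Multiset {J : ι → α // Function.Injective J}, s.card ≤ D → t.card ≤ D →
      (∀ l, (s.map fun y => y.1 l) = t.map fun y => y.1 l) → (s.map f).prod = (t.map f).prod)
    (s t : Multiset {J : ι → α // Function.Injective J})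
    (hst : ∀ l, (s.map fun y => y.1 l) = t.map fun y => y.1 l) :
    (s.map f).prod = (t.map f).prod := by
  classical
  induction hn : s.card generalizing s t with
  | zero =>
    have h := congrArg Multiset.card (hst (Classical.arbitrary ι))
    simp only [Multiset.card_map] at h
    exact hf s t (by omega) (by omega) hst
  | succ n ih =>
    have h := congrArg Multiset.card (hst (Classical.arbitrary ι))
    simp only [Multiset.card_map] at h
    by_cases hc : s.card ≤ D
    · exact hf s t hc (h ▸ hc) hst
    · obtain ⟨y, hy, z, hz, w, hw⟩ := exists_common_members s t hst (by omega)
      obtain ⟨s, rfl⟩ := Multiset.exists_cons_of_mem hy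
      obtain ⟨t, rfl⟩ := Multiset.exists_cons_of_mem hz
      have hcw := congrArg Multiset.card (hw (Classical.arbitrary ι))
      simp only [Multiset.card_map, Multiset.card_cons] at hcw hn
      have h1 := ih s (z ::ₘ w) (fun l => by simpa using (hw l).symm) (by omega)
      have h2 := ih (y ::ₘ w) t (fun l => by
        have := (hw l).trans (hst l)
        rw [Multiset.cons_swap] at this
        simpa using this) (by simp only [Multiset.card_cons]; omega)
      rw [Multiset.map_cons, Multiset.prod_cons, h1, Multiset.map_cons, Multiset.prod_cons,
        Multiset.map_cons, Multiset.prod_cons, ← h2, Multiset.map_cons, Multiset.prod_cons,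
        mul_left_comm]

/-- The members of the `p`-th summand in a multiset of elements of a sigma type. -/
def Multiset.sigmaPart {ι : Type*} [DecidableEq ι] {β : ι → Type*} (p : ι)
    (s : Multiset (Σ i, β i)) : Multiset (β p) :=
  s.filterMap fun y => if h : y.1 = p then some (h ▸ y.2) else none

theorem Multiset.sigmaPart_cons_self {ι : Type*} [DecidableEq ι] {β : ι → Type*} (p : ι)
    (b : β p) (s : Multiset (Σ i, β i)) :
    (⟨p, b⟩ ::ₘ s : Multiset (Σ i, β i)).sigmaPart p = b ::ₘ s.sigmaPart p :=
  Multiset.filterMap_cons_some _ _ _ (by simp)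

theorem Multiset.sigmaPart_cons_of_ne {ι : Type*} [DecidableEq ι] {β : ι → Type*} {p q : ι}
    (h : q ≠ p) (b : β q) (s : Multiset (Σ i, β i)) :
    (⟨q, b⟩ ::ₘ s : Multiset (Σ i, β i)).sigmaPart p = s.sigmaPart p :=
  Multiset.filterMap_cons_none _ _ (by simp [h])

theorem Multiset.prod_map_sigmaPart_cons {ι : Type*} [DecidableEq ι] {β : ι → Type*} {M : Type*}
    [CommMonoid M] (p : ι) (f : (Σ i, β i) → M) (y : Σ i, β i) (s : Multiset (Σ i, β i)) :
    (((y ::ₘ s).sigmaPart p).map fun b => f ⟨p, b⟩).prod =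
      (if y.1 = p then f y else 1) * ((s.sigmaPart p).map fun b => f ⟨p, b⟩).prod := by
  obtain ⟨q, b⟩ := y
  by_cases h : q = p
  · subst h
    simp [sigmaPart_cons_self]
  · simp [sigmaPart_cons_of_ne h, h]

theorem Multiset.prod_map_eq_prod_sigmaPart {ι : Type*} [Fintype ι] [DecidableEq ι]
    {β : ι → Type*} {M : Type*} [CommMonoid M] (f : (Σ i, β i) → M) (s : Multiset (Σ i, β i)) :
    (s.map f).prod = ∏ p, ((s.sigmaPart p).map fun b => f ⟨p, b⟩).prod := by
  induction s using Multiset.induction_on with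
  | empty => simp [sigmaPart]
  | cons y s ih =>
    simp_rw [prod_map_sigmaPart_cons, Finset.prod_mul_distrib]
    simp [ih]

/-- The index of the variable `y_{p,J}`. -/
def YIdx.of {N : ℕ} {k : Fin N → ℕ} (p : Fin N)
    (J : {J : Fin (k p) → ℕ // Function.Injective J}) : YIdx N k :=
  ⟨p, J⟩

/-- The index of the variable `x_{p,l,j}`. -/
def XIdxM.of {N : ℕ} {k : Fin N → ℕ} (p : Fin N) (l : Fin (k p)) (j : ℕ) : XIdxM N k :=
  ⟨p, (l, j)⟩

/-- The exponent vector of the monomial `φ(y_{p,J})`. -/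
noncomputable def matchingExponent {N : ℕ} {k : Fin N → ℕ} (y : YIdx N k) : XIdxM N k →₀ ℕ :=
  ∑ l : Fin (k y.1), Finsupp.single (XIdxM.of y.1 l (y.2.1 l)) 1

theorem sum_map_matchingExponent_apply {N : ℕ} {k : Fin N → ℕ} (s : Multiset (YIdx N k))
    (p : Fin N) (l : Fin (k p)) (j : ℕ) :
    (s.map matchingExponent).sum (XIdxM.of p l j) =
      ((Multiset.sigmaPart p s).map fun J => J.1 l).count j := by
  classical
  induction s using Multiset.induction_on with
  | empty => rfl
  | cons y s ih =>
    rw [Multiset.map_cons, Multiset.sum_cons, Finsupp.add_apply, ih]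
    obtain ⟨q, J⟩ := y
    by_cases h : q = p
    · subst h
      refine Eq.trans ?_ (congrArg (fun m => (m.map fun J => J.1 l).count j)
        (Multiset.sigmaPart_cons_self q J s).symm)
      rw [Multiset.map_cons, Multiset.count_cons, add_comm]
      congr 1
      simp only [matchingExponent, Finsupp.finsetSum_apply]
      rw [Finset.sum_eq_single l]
      · rw [Finsupp.single_apply]
        refine if_congr ⟨fun h => ?_, fun h => ?_⟩ rfl rfl
        · cases h; rfl
        · subst h; rfl
      · intro l' _ hl'
        refine Finsupp.single_eq_of_ne fun h => hl' ?_
        cases h; rfl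
      · simp
    · refine Eq.trans ?_ (congrArg (fun m => (m.map fun J => J.1 l).count j)
        (Multiset.sigmaPart_cons_of_ne h J s).symm)
      simp only [matchingExponent, Finsupp.finsetSum_apply]
      rw [Finset.sum_eq_zero, zero_add]
      intro l' _
      refine Finsupp.single_eq_of_ne fun h' => h ?_
      cases h'; rfl

theorem monomial_one_eq_prod_map_X {σ R : Type*} [CommSemiring R] (u : σ →₀ ℕ) :
    (monomial u 1 : MvPolynomial σ R) = (u.toMultiset.map X).prod := by
  rw [monomial_eq, C_1, one_mul, Finsupp.toMultiset_map, Finsupp.prod_toMultiset,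
    Finsupp.prod_mapDomain_index (fun _ => pow_zero _) fun _ _ _ => pow_add _ _ _]

theorem matchingPhi_X (R : Type) [CommRing R] {N : ℕ} {k : Fin N → ℕ} (y : YIdx N k) :
    matchingPhi R N k (X y) = monomial (matchingExponent y) 1 := by
  rw [matchingPhi, aeval_X, matchingExponent, monomial_sum_one]
  rfl

theorem matchingPhi_monomial_one (R : Type) [CommRing R] {N : ℕ} {k : Fin N → ℕ}
    (u : YIdx N k →₀ ℕ) :
    matchingPhi R N k (monomial u 1) =
      monomial ((u.toMultiset.map matchingExponent).sum) 1 := by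
  rw [monomial_one_eq_prod_map_X, map_multiset_prod, Multiset.map_map]
  simp only [Function.comp_def, matchingPhi_X]
  induction u.toMultiset using Multiset.induction_on with
  | empty => simp
  | cons y s ih =>
    simp only [Multiset.map_cons, Multiset.prod_cons, Multiset.sum_cons, ih, monomial_mul, one_mul]

theorem matchingPhi_prod_X_eq (R : Type) [CommRing R] {N : ℕ} {k : Fin N → ℕ} (p : Fin N)
    (s t : Multiset {J : Fin (k p) → ℕ // Function.Injective J})
    (hst : ∀ l, (s.map fun y => y.1 l) = t.map fun y => y.1 l) :
    matchingPhi R N k ((s.map fun J => X (YIdx.of p J)).prod) =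
      matchingPhi R N k ((t.map fun J => X (YIdx.of p J)).prod) := by
  have key : ∀ s : Multiset {J : Fin (k p) → ℕ // Function.Injective J},
      matchingPhi R N k ((s.map fun J => X (YIdx.of p J)).prod) =
        ∏ l, ((s.map fun J => J.1 l).map fun j =>
          (X (XIdxM.of p l j) : MvPolynomial (XIdxM N k) R)).prod := fun s => by
    simp only [map_multiset_prod, Multiset.map_map, ← Multiset.prod_map_prod, matchingPhi,
      Function.comp_def, aeval_X]
    rfl
  simp only [key, hst]

/-- `ker φ` is generated by the binomials it contains of total degree at most
`2·max_p k_p − 1`. -/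
theorem kernel_generated_by_bounded_binomials (R : Type) [CommRing R]
    (N : ℕ) (hN : 1 ≤ N) (k : Fin N → ℕ) (hk : ∀ p, 1 ≤ k p) :
    RingHom.ker (matchingPhi R N k) =
      Ideal.span {b : MvPolynomial (YIdx N k) R |
        b ∈ RingHom.ker (matchingPhi R N k) ∧
        ∃ u v : YIdx N k →₀ ℕ, b = monomial u 1 - monomial v 1 ∧
          (u.sum fun _ n => n) ≤ 2 * Finset.univ.sup k - 1 ∧
          (v.sum fun _ n => n) ≤ 2 * Finset.univ.sup k - 1} := by
  classical
  set I := Ideal.span {b : MvPolynomial (YIdx N k) R |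
        b ∈ RingHom.ker (matchingPhi R N k) ∧
        ∃ u v : YIdx N k →₀ ℕ, b = monomial u 1 - monomial v 1 ∧
          (u.sum fun _ n => n) ≤ 2 * Finset.univ.sup k - 1 ∧
          (v.sum fun _ n => n) ≤ 2 * Finset.univ.sup k - 1}
  have hpart : ∀ (p : Fin N) (s t : Multiset {J : Fin (k p) → ℕ // Function.Injective J}),
      (∀ l, (s.map fun y => y.1 l) = t.map fun y => y.1 l) →
      (s.map fun J => Ideal.Quotient.mk I (X (YIdx.of p J))).prod =
        (t.map fun J => Ideal.Quotient.mk I (X (YIdx.of p J))).prod := by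
    intro p s t hst
    have hkp : k p ≤ Finset.univ.sup k := Finset.le_sup (Finset.mem_univ p)
    have : Nonempty (Fin (k p)) := ⟨⟨0, hk p⟩⟩
    rcases (hk p).eq_or_lt with h1 | h1
    · have : Subsingleton (Fin (k p)) := by rw [← h1]; infer_instance
      have hinj : Function.Injective fun J : {J : Fin (k p) → ℕ // Function.Injective J} =>
          J.1 ⟨0, hk p⟩ := fun J J' h => Subtype.ext (funext fun l => by
        rw [Subsingleton.elim l ⟨0, hk p⟩]; exact h)
      rw [Multiset.map_injective hinj (hst _)]
    · refine prod_map_eq_of_bounded _ (D := 2 * Finset.univ.sup k - 1)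
        (by rw [Fintype.card_fin]; omega) ?_ s t hst
      intro s t hs ht hst
      have hmon : ∀ s : Multiset {J : Fin (k p) → ℕ // Function.Injective J},
          (monomial (Multiset.toFinsupp (s.map fun J => (YIdx.of p J))) 1 :
            MvPolynomial (YIdx N k) R) = (s.map fun J => X (YIdx.of p J)).prod := fun s => by
        rw [monomial_one_eq_prod_map_X, Multiset.toFinsupp_toMultiset, Multiset.map_map]
        rfl
      have hdeg : ∀ s : Multiset {J : Fin (k p) → ℕ // Function.Injective J},
          ((Multiset.toFinsupp (s.map fun J => (YIdx.of p J))).sum fun _ n => n) =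
            s.card := fun s => by
        rw [← Multiset.card_map (YIdx.of p) s, ← Multiset.toFinsupp_toMultiset (s.map _),
          Finsupp.card_toMultiset, Multiset.toFinsupp_toMultiset]
        rfl
      have hmem : (s.map fun J => X (YIdx.of p J)).prod -
          (t.map fun J => X (YIdx.of p J)).prod ∈ I := by
        refine Ideal.subset_span ⟨?_, _, _, by rw [← hmon s, ← hmon t],
          by rwa [hdeg], by rwa [hdeg]⟩
        rw [RingHom.mem_ker, map_sub, matchingPhi_prod_X_eq R p s t hst, sub_self]
      have := Ideal.Quotient.eq.2 hmem
      simpa only [map_multiset_prod, Multiset.map_map, Function.comp_def] using this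
  have hbinom : ∀ u v : YIdx N k →₀ ℕ,
      (u.toMultiset.map matchingExponent).sum = (v.toMultiset.map matchingExponent).sum →
      Ideal.Quotient.mk I (monomial u 1) = Ideal.Quotient.mk I (monomial v 1) := by
    intro u v huv
    have hprod : ∀ u : YIdx N k →₀ ℕ, Ideal.Quotient.mk I (monomial u 1) =
        ∏ p, ((Multiset.sigmaPart p u.toMultiset).map fun J =>
          Ideal.Quotient.mk I (X (YIdx.of p J))).prod := fun u => by
      rw [monomial_one_eq_prod_map_X, map_multiset_prod, Multiset.map_map]
      exact Multiset.prod_map_eq_prod_sigmaPart _ _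
    rw [hprod, hprod]
    refine Finset.prod_congr rfl fun p _ => hpart p _ _ fun l => ?_
    ext j
    rw [← sum_map_matchingExponent_apply, huv, sum_map_matchingExponent_apply]
  refine le_antisymm (fun g hg => ?_) (Ideal.span_le.2 fun b hb => hb.1)
  let F : (YIdx N k →₀ ℕ) → (XIdxM N k →₀ ℕ) := fun u => (u.toMultiset.map matchingExponent).sum
  let ψ : MvPolynomial (XIdxM N k) R →ₗ[R] MvPolynomial (YIdx N k) R ⧸ I :=
    (basisMonomials (XIdxM N k) R).constr R fun m =>
      Ideal.Quotient.mk I (monomial (Function.invFun F m) 1)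
  have hψ : ψ ∘ₗ (matchingPhi R N k).toLinearMap = (Ideal.Quotient.mkₐ R I).toLinearMap := by
    refine (basisMonomials (YIdx N k) R).ext fun u => ?_
    have h := (basisMonomials (XIdxM N k) R).constr_basis R (fun m =>
      Ideal.Quotient.mk I (monomial (Function.invFun F m) (1 : R))) (F u)
    rw [coe_basisMonomials] at h
    simp only [coe_basisMonomials, LinearMap.comp_apply, AlgHom.toLinearMap_apply,
      matchingPhi_monomial_one]
    exact h.trans (hbinom _ _ (Function.invFun_eq (f := F) ⟨u, rfl⟩))
  have h := LinearMap.congr_fun hψ g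
  rw [LinearMap.comp_apply, AlgHom.toLinearMap_apply, RingHom.mem_ker.1 hg, map_zero] at h
  exact Ideal.Quotient.eq_zero_iff_mem.1 h.symm
end

section
/- Let R be a Noetherian commutative ring, fix N ≥ 1 and integers k_p ≥ 1 for p ∈ [N], and let X = {x_{p,l,j} : p ∈ [N], l ∈ [k_p], j ∈ ℕ} with Inc(ℕ) acting on R[X] by R-algebra endomorphisms via π·x_{p,l,j} = x_{p,l,π(j)}. Let S be the R-linear span in R[X] of the monomials x^A := ∏_{p,l,j} x_{p,l,j}^{(A_p)_{l,j}} over all good tuples A; then S is an Inc(ℕ)-stable R-subalgebra of R[X], and S is Inc(ℕ)-Noetherian: every Inc(ℕ)-stable ideal of S is generated by the union of finitely many Inc(ℕ)-orbits of its elements. -/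
open MvPolynomial

/-- A tuple `A = (A_p)_p` of matrices (encoded as one finitely supported exponent vector
on `X`) is good: for every `p` all row sums of `A_p` are equal to some `d_p` and all
column sums of `A_p` are at most `d_p`. -/
def GoodTupleF (N : ℕ) (k : Fin N → ℕ) (A : XIdxM N k →₀ ℕ) : Prop :=
  ∀ p : Fin N, ∃ d : ℕ,
    (∀ l : Fin (k p), ∑ᶠ j : ℕ, A ⟨p, (l, j)⟩ = d) ∧
    ∀ j : ℕ, (∑ l : Fin (k p), A ⟨p, (l, j)⟩) ≤ d

/-- The action of a map `π : ℕ → ℕ` on the index set `X`: `x_{p,l,j} ↦ x_{p,l,π(j)}`. -/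
def incX {N : ℕ} {k : Fin N → ℕ} (π : ℕ → ℕ) (x : XIdxM N k) : XIdxM N k :=
  ⟨x.1, (x.2.1, π x.2.2)⟩

/-- **Higman's lemma** for words presented as functions on initial segments of `ℕ`; the
embeddings of words are extended to strictly increasing maps `ℕ → ℕ`. -/
lemma exists_subseq_wordEmbedding {α : Type*} [Preorder α] [WellQuasiOrderedLE α]
    (w : ℕ → ℕ → α) (L : ℕ → ℕ) :
    ∃ g : ℕ ↪o ℕ, ∀ m n : ℕ, m ≤ n → ∃ π : ℕ → ℕ, StrictMono π ∧
      (∀ j < L (g m), π j < L (g n) ∧ w (g m) j ≤ w (g n) (π j)) ∧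
      ∀ j, L (g m) ≤ j → L (g n) ≤ π j := by
  have hα : (Set.univ : Set α).PartiallyWellOrderedOn (· ≤ ·) :=
    Set.partiallyWellOrderedOn_of_wellQuasiOrdered wellQuasiOrdered_le _
  have : IsPreorder (List α) (List.SublistForall₂ (· ≤ · : α → α → Prop)) := { }
  obtain ⟨g, hg⟩ := (Set.PartiallyWellOrderedOn.partiallyWellOrderedOn_sublistForall₂
    (· ≤ ·) hα).exists_monotone_subseq (f := fun n => (List.range (L n)).map (w n))
      (fun n x _ => Set.mem_univ x)
  refine ⟨g, fun m n hmn => ?_⟩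
  obtain ⟨l, hl, hsub⟩ := List.sublistForall₂_iff.1 (hg m n hmn)
  obtain ⟨π, hπ⟩ := List.sublist_iff_exists_orderEmbedding_getElem?_eq.1 hsub
  obtain ⟨hlen, hle⟩ := List.forall₂_iff_get.1 hl
  simp only [List.length_map, List.length_range] at hlen
  refine ⟨π, π.strictMono, fun j hj => ?_, fun j hj => ?_⟩
  · have h1 := hπ j
    rw [List.getElem?_eq_getElem (hlen ▸ hj), eq_comm, List.getElem?_eq_some_iff] at h1
    obtain ⟨h2, h3⟩ := h1
    have h4 := hle j (by simpa using hj) (hlen ▸ hj)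
    simp only [List.length_map, List.length_range] at h2
    refine ⟨h2, ?_⟩
    simp only [List.get_eq_getElem, ← h3] at h4
    simpa using h4
  · have h1 := hπ j
    rw [List.getElem?_eq_none (hlen ▸ hj), eq_comm, List.getElem?_eq_none_iff] at h1
    simpa using h1

lemma exists_forall_le_of_bounded {c : ℕ → ℕ} {C : ℕ} (hC : ∀ n, c n ≤ C) :
    ∃ n₀, ∀ n, c n ≤ c n₀ := by
  have hb : BddAbove (Set.range c) := ⟨C, by rintro _ ⟨n, rfl⟩; exact hC n⟩
  obtain ⟨n₀, h⟩ := Nat.sSup_mem (Set.range_nonempty c) hb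
  exact ⟨n₀, fun n => h ▸ le_csSup hb ⟨n, rfl⟩⟩

section GoodTuples

variable {N : ℕ} {k : Fin N → ℕ}

lemma incX_injective {π : ℕ → ℕ} (hπ : StrictMono π) :
    Function.Injective (incX π : XIdxM N k → XIdxM N k) := by
  rintro ⟨p, l, i⟩ ⟨q, l', j⟩ h
  obtain ⟨rfl, h⟩ := Sigma.mk.inj_iff.1 h
  obtain ⟨h₁, h₂⟩ := Prod.mk_inj.1 (eq_of_heq h)
  obtain rfl : l = l' := h₁
  obtain rfl : i = j := hπ.injective h₂
  rfl

/-- The sum of the `j`-th column of the `p`-th matrix of the tuple `A`. -/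
def colSum (A : XIdxM N k →₀ ℕ) (p : Fin N) (j : ℕ) : ℕ := ∑ l : Fin (k p), A ⟨p, (l, j)⟩

/-- The sum of the `l`-th row of the `p`-th matrix of the tuple `A`. -/
noncomputable def rowSum (A : XIdxM N k →₀ ℕ) (p : Fin N) (l : Fin (k p)) : ℕ :=
  ∑ᶠ j : ℕ, A ⟨p, (l, j)⟩

/-- The tuple `A` is good, with row sums given by `d`. -/
def IsGoodOfDegree (A : XIdxM N k →₀ ℕ) (d : Fin N → ℕ) : Prop :=
  ∀ p, (∀ l, rowSum A p l = d p) ∧ ∀ j, colSum A p j ≤ d p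

lemma goodTupleF_iff {A : XIdxM N k →₀ ℕ} :
    GoodTupleF N k A ↔ ∃ d, IsGoodOfDegree A d :=
  Classical.skolem

lemma rowSum_support_finite (A : XIdxM N k →₀ ℕ) (p : Fin N) (l : Fin (k p)) :
    (Function.support fun j => A ⟨p, (l, j)⟩).Finite := by
  refine Set.Finite.preimage (f := fun j => (⟨p, (l, j)⟩ : XIdxM N k)) ?_ A.hasFiniteSupport
  intro i _ j _ h
  simpa using congrArg (fun x : XIdxM N k => x.2.2) h

lemma rowSum_add (A B : XIdxM N k →₀ ℕ) (p : Fin N) (l : Fin (k p)) :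
    rowSum (A + B) p l = rowSum A p l + rowSum B p l :=
  finsum_add_distrib (rowSum_support_finite A p l) (rowSum_support_finite B p l)

lemma colSum_add (A B : XIdxM N k →₀ ℕ) (p : Fin N) (j : ℕ) :
    colSum (A + B) p j = colSum A p j + colSum B p j :=
  Finset.sum_add_distrib

lemma mapDomain_incX_apply {π : ℕ → ℕ} (hπ : StrictMono π) (A : XIdxM N k →₀ ℕ)
    (p : Fin N) (l : Fin (k p)) (j : ℕ) :
    A.mapDomain (incX π) ⟨p, (l, π j)⟩ = A ⟨p, (l, j)⟩ :=
  Finsupp.mapDomain_apply (incX_injective hπ) A ⟨p, (l, j)⟩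

lemma mapDomain_incX_of_notMem {π : ℕ → ℕ} (A : XIdxM N k →₀ ℕ)
    (p : Fin N) (l : Fin (k p)) {j : ℕ} (hj : j ∉ Set.range π) :
    A.mapDomain (incX π) ⟨p, (l, j)⟩ = 0 := by
  refine Finsupp.mapDomain_of_not_mem_image_support ?_
  rintro ⟨x, -, hx⟩
  exact hj ⟨x.2.2, congrArg (fun x : XIdxM N k => x.2.2) hx⟩

lemma rowSum_mapDomain {π : ℕ → ℕ} (hπ : StrictMono π) (A : XIdxM N k →₀ ℕ)
    (p : Fin N) (l : Fin (k p)) :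
    rowSum (A.mapDomain (incX π)) p l = rowSum A p l := by
  have h : ∑ᶠ j ∈ Set.range π, A.mapDomain (incX π) ⟨p, (l, j)⟩ =
      ∑ᶠ j, A.mapDomain (incX π) ⟨p, (l, j)⟩ := by
    rw [← finsum_mem_univ fun j => A.mapDomain (incX π) ⟨p, (l, j)⟩]
    refine finsum_mem_inter_support_eq' _ _ _ fun j hj => ?_
    simp only [Set.mem_univ, iff_true]
    by_contra h
    exact hj (mapDomain_incX_of_notMem A p l h)
  rw [rowSum, ← h, finsum_mem_range hπ.injective]
  simp only [mapDomain_incX_apply hπ, rowSum]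

lemma colSum_mapDomain {π : ℕ → ℕ} (hπ : StrictMono π) (A : XIdxM N k →₀ ℕ)
    (p : Fin N) (j : ℕ) :
    colSum (A.mapDomain (incX π)) p (π j) = colSum A p j := by
  simp only [colSum, mapDomain_incX_apply hπ]

lemma colSum_mapDomain_of_notMem {π : ℕ → ℕ} (A : XIdxM N k →₀ ℕ)
    (p : Fin N) {j : ℕ} (hj : j ∉ Set.range π) :
    colSum (A.mapDomain (incX π)) p j = 0 := by
  simp only [colSum, mapDomain_incX_of_notMem A p _ hj, Finset.sum_const_zero]

lemma GoodTupleF.zero : GoodTupleF N k 0 := 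
  fun _ => ⟨0, fun _ => finsum_zero, fun _ => Finset.sum_const_zero.le⟩

lemma GoodTupleF.add {A B : XIdxM N k →₀ ℕ} (hA : GoodTupleF N k A) (hB : GoodTupleF N k B) :
    GoodTupleF N k (A + B) := by
  obtain ⟨d, hd⟩ := goodTupleF_iff.1 hA
  obtain ⟨e, he⟩ := goodTupleF_iff.1 hB
  refine goodTupleF_iff.2 ⟨d + e, fun p => ⟨fun l => ?_, fun j => ?_⟩⟩
  · rw [rowSum_add, (hd p).1, (he p).1, Pi.add_apply]
  · rw [colSum_add]
    exact add_le_add ((hd p).2 j) ((he p).2 j)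

lemma GoodTupleF.mapDomain {A : XIdxM N k →₀ ℕ} (hA : GoodTupleF N k A) {π : ℕ → ℕ}
    (hπ : StrictMono π) : GoodTupleF N k (A.mapDomain (incX π)) := by
  obtain ⟨d, hd⟩ := goodTupleF_iff.1 hA
  refine goodTupleF_iff.2 ⟨d, fun p => ⟨fun l => ?_, fun j => ?_⟩⟩
  · rw [rowSum_mapDomain hπ, (hd p).1]
  · by_cases hj : j ∈ Set.range π
    · obtain ⟨i, rfl⟩ := hj
      rw [colSum_mapDomain hπ]
      exact (hd p).2 i
    · rw [colSum_mapDomain_of_notMem A p hj]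
      exact Nat.zero_le _

/-- Divisibility of good monomials up to the action of `Inc(ℕ)`. -/
def IncDvd (A B : XIdxM N k →₀ ℕ) : Prop :=
  ∃ π : ℕ → ℕ, StrictMono π ∧ ∃ C, GoodTupleF N k C ∧ B = A.mapDomain (incX π) + C

lemma IncDvd.refl (A : XIdxM N k →₀ ℕ) : IncDvd A A :=
  ⟨id, strictMono_id, 0, GoodTupleF.zero, (Finsupp.mapDomain_id.symm.trans (add_zero _).symm)⟩

lemma IncDvd.trans {A B C : XIdxM N k →₀ ℕ} (h₁ : IncDvd A B) (h₂ : IncDvd B C) :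
    IncDvd A C := by
  obtain ⟨π, hπ, D, hD, rfl⟩ := h₁
  obtain ⟨ρ, hρ, E, hE, rfl⟩ := h₂
  refine ⟨ρ ∘ π, hρ.comp hπ, D.mapDomain (incX ρ) + E, (hD.mapDomain hρ).add hE, ?_⟩
  rw [Finsupp.mapDomain_add, add_assoc, ← Finsupp.mapDomain_comp]
  rfl

instance : IsPreorder (XIdxM N k →₀ ℕ) IncDvd where
  refl := IncDvd.refl
  trans _ _ _ := IncDvd.trans

lemma incDvd_of_dominates {A B : XIdxM N k →₀ ℕ} {d e : Fin N → ℕ}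
    (hA : IsGoodOfDegree A d) (hB : IsGoodOfDegree B e) {π : ℕ → ℕ} (hπ : StrictMono π)
    (hle : ∀ p l j, A ⟨p, (l, j)⟩ ≤ B ⟨p, (l, π j)⟩)
    (hcol : ∀ p j, d p + colSum B p (π j) ≤ e p + colSum A p j)
    (hout : ∀ p, ∀ j ∉ Set.range π, d p + colSum B p j ≤ e p) : IncDvd A B := by
  have hAB : A.mapDomain (incX π) ≤ B := by
    rintro ⟨p, l, j⟩
    by_cases hj : j ∈ Set.range π
    · obtain ⟨i, rfl⟩ := hj
      rw [mapDomain_incX_apply hπ]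
      exact hle p l i
    · rw [mapDomain_incX_of_notMem A p l hj]
      exact Nat.zero_le _
  obtain ⟨C, rfl⟩ := exists_add_of_le hAB
  refine ⟨π, hπ, C, goodTupleF_iff.2 ⟨e - d, fun p => ⟨fun l => ?_, fun j => ?_⟩⟩, rfl⟩
  · have h := (hB p).1 l
    rw [rowSum_add, rowSum_mapDomain hπ, (hA p).1] at h
    rw [Pi.sub_apply]
    omega
  · rw [Pi.sub_apply]
    by_cases hj : j ∈ Set.range π
    · obtain ⟨i, rfl⟩ := hj
      have h := hcol p i
      rw [colSum_add, colSum_mapDomain hπ] at h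
      omega
    · have h := hout p j hj
      rw [colSum_add, colSum_mapDomain_of_notMem A p hj] at h
      omega

lemma exists_support_bound (A : XIdxM N k →₀ ℕ) :
    ∃ L, ∀ p l j, L ≤ j → A ⟨p, (l, j)⟩ = 0 := by
  refine ⟨A.support.sup (fun x => x.2.2 + 1), fun p l j hj => ?_⟩
  by_contra h
  have := Finset.le_sup (f := fun x : XIdxM N k => x.2.2 + 1) (Finsupp.mem_support_iff.2 h)
  exact absurd (this.trans hj) (by simp)

lemma sum_colSum_le {A : XIdxM N k →₀ ℕ} {d : Fin N → ℕ} (hA : IsGoodOfDegree A d)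
    (p : Fin N) (s : Finset ℕ) : ∑ j ∈ s, colSum A p j ≤ k p * d p := by
  have h : ∀ l, ∑ j ∈ s, A ⟨p, (l, j)⟩ ≤ d p := fun l => by
    rw [← (hA p).1 l, rowSum, finsum_eq_sum _ (rowSum_support_finite A p l)]
    refine Finset.sum_le_sum_of_ne_zero fun j _ hj => ?_
    simpa using hj
  simp only [colSum]
  rw [Finset.sum_comm]
  exact (Finset.sum_le_sum fun l _ => h l).trans (by simp)

lemma card_nonzero_columns_le {A : XIdxM N k →₀ ℕ} {d : Fin N → ℕ} (hA : IsGoodOfDegree A d)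
    (p : Fin N) (s : Finset ℕ) (hs : ∀ j ∈ s, colSum A p j ≠ 0) : s.card ≤ k p * d p := by
  refine le_trans ?_ (sum_colSum_le hA p s)
  simpa using Finset.card_nsmul_le_sum s (colSum A p) 1 fun j hj => Nat.pos_of_ne_zero (hs j hj)

lemma card_large_columns_le {A : XIdxM N k →₀ ℕ} {d : Fin N → ℕ} (hA : IsGoodOfDegree A d)
    (p : Fin N) (s : Finset ℕ) (hs : ∀ j ∈ s, d p < 2 * colSum A p j) : s.card ≤ 2 * k p := by
  have h1 : s.card * (d p + 1) ≤ 2 * (k p * d p) := by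
    refine le_trans ?_ (Nat.mul_le_mul_left 2 (sum_colSum_le hA p s))
    rw [Finset.mul_sum]
    simpa using Finset.card_nsmul_le_sum s (fun j => 2 * colSum A p j) (d p + 1) hs
  by_contra! h2
  nlinarith [Nat.mul_le_mul_right (d p + 1) h2.le]

/-- In a bounded family of degrees a column is special when it is nonzero, otherwise it is
special when its sum exceeds half of the degree. -/
def IsSpecialColumn (b : Fin N → Prop) (A : XIdxM N k →₀ ℕ) (d : Fin N → ℕ) (j : ℕ) : Prop :=
  ∃ p, (b p ∧ colSum A p j ≠ 0) ∨ (¬ b p ∧ d p < 2 * colSum A p j)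

open Classical in
lemma card_special_columns_le {A : XIdxM N k →₀ ℕ} {b : Fin N → Prop} {M d : Fin N → ℕ}
    (hA : IsGoodOfDegree A d) (hM : ∀ p, b p → d p ≤ M p)
    (s : Finset ℕ) (hs : ∀ j ∈ s, IsSpecialColumn b A d j) :
    s.card ≤ ∑ p, (k p * M p + 2 * k p) := by
  have h : s ⊆ Finset.univ.biUnion fun p =>
      s.filter fun j => (b p ∧ colSum A p j ≠ 0) ∨ (¬ b p ∧ d p < 2 * colSum A p j) := by
    intro j hj
    obtain ⟨p, hp⟩ := hs j hj
    exact Finset.mem_biUnion.2 ⟨p, Finset.mem_univ p, Finset.mem_filter.2 ⟨hj, hp⟩⟩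
  refine (Finset.card_le_card h).trans (Finset.card_biUnion_le.trans
    (Finset.sum_le_sum fun p _ => ?_))
  by_cases hp : b p
  · refine ((card_nonzero_columns_le hA p _ fun j hj => ?_).trans
      (Nat.mul_le_mul_left _ (hM p hp))).trans (Nat.le_add_right _ _)
    simpa [hp] using (Finset.mem_filter.1 hj).2
  · refine (card_large_columns_le hA p _ fun j hj => ?_).trans (Nat.le_add_left _ _)
    simpa [hp] using (Finset.mem_filter.1 hj).2

open Classical in
/-- Monotone-degree case of the well-quasi-order property of divisibility up to `Inc(ℕ)`. -/
lemma exists_lt_incDvd_of_monotone (a : ℕ → XIdxM N k →₀ ℕ) (d : ℕ → Fin N → ℕ)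
    (ha : ∀ n, IsGoodOfDegree (a n) (d n)) (hd : Monotone d) :
    ∃ m n, m < n ∧ IncDvd (a m) (a n) := by
  choose L hL using fun n => exists_support_bound (a n)
  have hcol0 : ∀ n p j, L n ≤ j → colSum (a n) p j = 0 := fun n p j hj =>
    Finset.sum_eq_zero fun l _ => hL n p l j hj
  let b : Fin N → Prop := fun p => ∃ M, ∀ n, d n p ≤ M
  obtain ⟨M, hM⟩ : ∃ M : Fin N → ℕ, ∀ p, b p → ∀ n, d n p ≤ M p := by
    refine Classical.skolem (p := fun p M => b p → ∀ n, d n p ≤ M).1 fun p => ?_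
    by_cases hp : b p
    · exact hp.imp fun M h _ => h
    · exact ⟨0, fun h => absurd h hp⟩
  let sp : ℕ → ℕ → Prop := fun n => IsSpecialColumn b (a n) (d n)
  let w : ℕ → ℕ → ((Σ p : Fin N, Fin (k p)) → ℕ) × (Fin N → ℕ) × ℕ := fun n j =>
    (fun x => a n ⟨x.1, (x.2, j)⟩, fun p => d n p - colSum (a n) p j, if sp n j then 1 else 0)
  obtain ⟨g, hg⟩ := exists_subseq_wordEmbedding w L
  let T : ℕ → Finset ℕ := fun n => (Finset.range (L n)).filter (sp n)
  obtain ⟨n₀, hn₀⟩ := exists_forall_le_of_bounded (c := fun t => (T (g t)).card) fun t =>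
    card_special_columns_le (ha (g t)) (fun p hp => hM p hp (g t)) (T (g t))
      fun j hj => (Finset.mem_filter.1 hj).2
  obtain ⟨t, ht, hdt⟩ : ∃ t, n₀ < t ∧ ∀ p, ¬ b p → 2 * d (g n₀) p ≤ d (g t) p := by
    have h : ∀ p, ∃ n, ¬ b p → 2 * d (g n₀) p ≤ d n p := fun p => by
      by_cases hp : b p
      · exact ⟨0, fun h => absurd hp h⟩
      · have h' := hp
        simp only [b, not_exists, not_forall, not_le] at h'
        exact (h' (2 * d (g n₀) p)).imp fun n hn _ => hn.le
    choose n hn using h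
    refine ⟨n₀ + 1 + ∑ p, n p, by omega, fun p hp => (hn p hp).trans (hd ?_ p)⟩
    refine le_trans ?_ (g.strictMono.le_apply)
    exact (Finset.single_le_sum (f := n) (fun _ _ => Nat.zero_le _)
      (Finset.mem_univ p)).trans (Nat.le_add_left _ _)
  refine ⟨g n₀, g t, g.strictMono ht, ?_⟩
  obtain ⟨π, hπ, hlt, hge⟩ := hg n₀ t ht.le
  have hdle : ∀ p, d (g n₀) p ≤ d (g t) p := hd (g.monotone ht.le)
  have hT : (T (g n₀)).image π = T (g t) := by
    refine Finset.eq_of_subset_of_card_le ?_ ?_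
    · intro i hi
      obtain ⟨j, hj, rfl⟩ := Finset.mem_image.1 hi
      obtain ⟨hj, hs⟩ := Finset.mem_filter.1 hj
      obtain ⟨h1, h2⟩ := hlt j (Finset.mem_range.1 hj)
      refine Finset.mem_filter.2 ⟨Finset.mem_range.2 h1, ?_⟩
      have h3 : (if sp (g n₀) j then 1 else 0) ≤ (if sp (g t) (π j) then 1 else 0) := h2.2.2
      by_contra h
      rw [if_pos hs, if_neg h] at h3
      omega
    · rw [Finset.card_image_of_injective _ hπ.injective]
      exact hn₀ t
  refine incDvd_of_dominates (ha _) (ha _) hπ (fun p l j => ?_) (fun p j => ?_)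
    (fun p j hj => ?_)
  · rcases lt_or_ge j (L (g n₀)) with hj | hj
    · exact (hlt j hj).2.1 ⟨p, l⟩
    · rw [hL _ p l j hj]
      exact Nat.zero_le _
  · rcases lt_or_ge j (L (g n₀)) with hj | hj
    · have h : d (g n₀) p - colSum (a (g n₀)) p j ≤ d (g t) p - colSum (a (g t)) p (π j) :=
        (hlt j hj).2.2.1 p
      have h1 := (ha (g n₀) p).2 j
      have h2 := (ha (g t) p).2 (π j)
      omega
    · rw [hcol0 _ p j hj, hcol0 _ p (π j) (hge j hj)]
      exact hdle p
  · have hns : ¬ sp (g t) j := fun hs => by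
      rcases lt_or_ge j (L (g t)) with hjL | hjL
      · have : j ∈ (T (g n₀)).image π :=
          hT ▸ Finset.mem_filter.2 ⟨Finset.mem_range.2 hjL, hs⟩
        obtain ⟨i, -, rfl⟩ := Finset.mem_image.1 this
        exact hj ⟨i, rfl⟩
      · obtain ⟨q, hq⟩ := hs
        rw [hcol0 _ q j hjL] at hq
        simp at hq
    simp only [sp, IsSpecialColumn, not_exists, not_or, not_and, not_not, not_lt] at hns
    have h1 := hdle p
    by_cases hp : b p
    · have h2 := (hns p).1 hp
      omega
    · have h2 := (hns p).2 hp
      have h3 := hdt p hp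
      omega

lemma goodTuples_partiallyWellOrderedOn :
    {A : XIdxM N k →₀ ℕ | GoodTupleF N k A}.PartiallyWellOrderedOn IncDvd := by
  rw [Set.partiallyWellOrderedOn_iff_exists_lt]
  intro a ha
  choose d hd using fun n => goodTupleF_iff.1 (ha n)
  obtain ⟨g, hg⟩ := (Set.isPWO_of_wellQuasiOrderedLE
    (Set.univ : Set (Fin N → ℕ))).exists_monotone_subseq (f := d) (fun n => Set.mem_univ _)
  obtain ⟨m, n, hmn, h⟩ := exists_lt_incDvd_of_monotone (a ∘ g) (d ∘ g) (fun n => hd (g n)) hg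
  exact ⟨g m, g n, g.strictMono hmn, h⟩

end GoodTuples

section MonomialOrder

variable {N : ℕ} {k : Fin N → ℕ}

/-- The linear order on the variables in which `x_{p,l,j}` is larger for smaller `j`. -/
noncomputable abbrev variableOrder (N : ℕ) (k : Fin N → ℕ) : LinearOrder (XIdxM N k) :=
  LinearOrder.lift' (β := (ℕ ×ₗ (Σₗ p : Fin N, Fin (k p)))ᵒᵈ)
    (fun x => OrderDual.toDual (toLex (x.2.2, toLex ⟨x.1, x.2.1⟩))) (by
      rintro ⟨p, l, i⟩ ⟨q, l', j⟩ h
      obtain ⟨h₁, h₂⟩ := Prod.mk_inj.1 (toLex.injective (OrderDual.toDual.injective h))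
      obtain ⟨rfl, h₃⟩ := Sigma.mk.inj_iff.1 (toLex.injective h₂)
      obtain rfl : l = l' := eq_of_heq h₃
      obtain rfl : i = j := h₁
      rfl)

lemma variableOrder_lt_iff {x y : XIdxM N k} :
    (variableOrder N k).lt x y ↔
      toLex (y.2.2, (toLex ⟨y.1, y.2.1⟩ : Σₗ p : Fin N, Fin (k p))) <
        toLex (x.2.2, (toLex ⟨x.1, x.2.1⟩ : Σₗ p : Fin N, Fin (k p))) :=
  Iff.rfl

lemma variableOrder_wellFoundedGT :
    @WellFoundedGT (XIdxM N k) (variableOrder N k).toLT := by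
  let := variableOrder N k
  have : WellFounded ((· < ·) : ℕ ×ₗ (Σₗ p : Fin N, Fin (k p)) → _ → Prop) := wellFounded_lt
  exact ⟨InvImage.wf (fun x : XIdxM N k =>
    (toLex (x.2.2, toLex ⟨x.1, x.2.1⟩) : ℕ ×ₗ (Σₗ p : Fin N, Fin (k p)))) this⟩

/-- The lexicographic monomial order attached to `variableOrder`. -/
noncomputable def incMonomialOrder (N : ℕ) (k : Fin N → ℕ) : MonomialOrder (XIdxM N k) :=
  letI := variableOrder N k
  haveI : WellFoundedGT (XIdxM N k) := variableOrder_wellFoundedGT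
  MonomialOrder.lex

lemma variableOrder_incX_lt {π : ℕ → ℕ} (hπ : StrictMono π) {x y : XIdxM N k}
    (h : (variableOrder N k).lt x y) : (variableOrder N k).lt (incX π x) (incX π y) := by
  rw [variableOrder_lt_iff, Prod.Lex.toLex_lt_toLex] at h ⊢
  exact h.imp (fun h => hπ h) fun h => ⟨congrArg π h.1, h.2⟩

lemma toLex_mapDomain_lt {σ : Type*} [LinearOrder σ] {f : σ → σ} (hf : StrictMono f)
    {A B : σ →₀ ℕ} (h : toLex A < toLex B) :
    toLex (A.mapDomain f) < toLex (B.mapDomain f) := by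
  obtain ⟨i, hi, hlt⟩ := Finsupp.Lex.lt_iff.1 h
  refine Finsupp.Lex.lt_iff.2 ⟨f i, fun j hj => ?_, ?_⟩
  · by_cases hr : j ∈ Set.range f
    · obtain ⟨j, rfl⟩ := hr
      simpa [Finsupp.mapDomain_apply hf.injective] using hi j (hf.lt_iff_lt.1 hj)
    · simp [Finsupp.mapDomain_of_notMem_range _ _ hr]
  · simpa [Finsupp.mapDomain_apply hf.injective] using hlt

lemma incMonomialOrder_mapDomain_le {π : ℕ → ℕ} (hπ : StrictMono π) {A B : XIdxM N k →₀ ℕ}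
    (h : (incMonomialOrder N k).toSyn A ≤ (incMonomialOrder N k).toSyn B) :
    (incMonomialOrder N k).toSyn (A.mapDomain (incX π)) ≤
      (incMonomialOrder N k).toSyn (B.mapDomain (incX π)) := by
  rcases h.lt_or_eq with h | h
  · let := variableOrder N k
    have hf : StrictMono (incX π : XIdxM N k → XIdxM N k) :=
      fun _ _ => variableOrder_incX_lt hπ
    exact (toLex_mapDomain_lt hf h).le
  · rw [(incMonomialOrder N k).toSyn.injective h]

end MonomialOrder

section MatchingMonoidAlgebra

variable (R : Type) [CommRing R] (N : ℕ) (k : Fin N → ℕ)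

/-- The subalgebra of polynomials all of whose monomials have good exponents. -/
noncomputable def matchingMonoidAlgebra : Subalgebra R (MvPolynomial (XIdxM N k) R) where
  carrier := {f | ∀ A, coeff A f ≠ 0 → GoodTupleF N k A}
  mul_mem' {f g} hf hg A hA := by
    classical
    rw [coeff_mul] at hA
    obtain ⟨⟨B, C⟩, hBC, hne⟩ := Finset.exists_ne_zero_of_sum_ne_zero hA
    rw [← Finset.HasAntidiagonal.mem_antidiagonal.1 hBC]
    exact (hf B (left_ne_zero_of_mul hne)).add (hg C (right_ne_zero_of_mul hne))
  add_mem' {f g} hf hg A hA := by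
    by_cases h : coeff A f = 0
    · exact hg A fun h' => hA (by rw [coeff_add, h, h', add_zero])
    · exact hf A h
  algebraMap_mem' r A hA := by
    classical
    rw [algebraMap_eq, coeff_C] at hA
    obtain rfl : 0 = A := by
      by_contra h
      exact hA (if_neg h)
    exact GoodTupleF.zero

variable {R N k}

lemma monomial_mem_matchingMonoidAlgebra {A : XIdxM N k →₀ ℕ} (hA : GoodTupleF N k A) (r : R) :
    monomial A r ∈ matchingMonoidAlgebra R N k := fun B hB => by
  classical
  rw [coeff_monomial] at hB
  obtain rfl : A = B := by
    by_contra h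
    exact hB (if_neg h)
  exact hA

lemma coe_matchingMonoidAlgebra :
    (matchingMonoidAlgebra R N k : Set (MvPolynomial (XIdxM N k) R)) =
      (Submodule.span R {f : MvPolynomial (XIdxM N k) R |
        ∃ A : XIdxM N k →₀ ℕ, GoodTupleF N k A ∧ f = monomial A 1} :
          Set (MvPolynomial (XIdxM N k) R)) := by
  refine Set.Subset.antisymm (fun f hf => ?_) ?_
  · rw [← support_sum_monomial_coeff f]
    refine Submodule.sum_mem _ fun A hA => ?_
    rw [← mul_one (coeff A f), ← smul_eq_mul, ← smul_monomial]
    exact Submodule.smul_mem _ _ (Submodule.subset_span ⟨A, hf A (mem_support_iff.1 hA), rfl⟩)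
  · change Submodule.span R _ ≤ Subalgebra.toSubmodule (matchingMonoidAlgebra R N k)
    refine Submodule.span_le.2 ?_
    rintro _ ⟨A, hA, rfl⟩
    exact monomial_mem_matchingMonoidAlgebra hA 1

lemma rename_mem_matchingMonoidAlgebra {π : ℕ → ℕ} (hπ : StrictMono π)
    {f : MvPolynomial (XIdxM N k) R} (hf : f ∈ matchingMonoidAlgebra R N k) :
    rename (incX π) f ∈ matchingMonoidAlgebra R N k := fun A hA => by
  obtain ⟨B, rfl, hB⟩ := coeff_rename_ne_zero _ _ _ hA
  exact (hf B hB).mapDomain hπ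

/-- The ideal of the matching monoid algebra generated by the `Inc(ℕ)`-orbits of the elements
of `F`. -/
noncomputable def orbitIdeal (F : Finset (matchingMonoidAlgebra R N k)) :
    Ideal (matchingMonoidAlgebra R N k) :=
  Ideal.span {g | ∃ f ∈ F, ∃ π : ℕ → ℕ, StrictMono π ∧
    (g : MvPolynomial (XIdxM N k) R) = rename (incX π) (f : MvPolynomial (XIdxM N k) R)}

/-- If the leading exponent of `f` divides `B` up to the action of `Inc(ℕ)`, then the orbit of `f`
generates an element with leading exponent at most `B` whose coefficient at `B` is the leading
coefficient of `f`. -/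
lemma exists_mem_orbitIdeal_of_incDvd {F : Finset (matchingMonoidAlgebra R N k)}
    {f : matchingMonoidAlgebra R N k} (hf : f ∈ F) {B : XIdxM N k →₀ ℕ}
    (hB : IncDvd ((incMonomialOrder N k).degree (f : MvPolynomial (XIdxM N k) R)) B) :
    ∃ h ∈ orbitIdeal F, (∀ A, coeff A (h : MvPolynomial (XIdxM N k) R) ≠ 0 →
        (incMonomialOrder N k).toSyn A ≤ (incMonomialOrder N k).toSyn B) ∧
      coeff B (h : MvPolynomial (XIdxM N k) R) =
        (incMonomialOrder N k).leadingCoeff (f : MvPolynomial (XIdxM N k) R) := by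
  classical
  obtain ⟨π, hπ, C, hC, rfl⟩ := hB
  refine ⟨⟨rename (incX π) f.1, rename_mem_matchingMonoidAlgebra hπ f.2⟩ *
    ⟨monomial C 1, monomial_mem_matchingMonoidAlgebra hC 1⟩,
    Ideal.mul_mem_right _ _ (Ideal.subset_span ⟨f, hf, π, hπ, rfl⟩), fun A hA => ?_, ?_⟩
  · change coeff A (rename (incX π) f.1 * monomial C 1) ≠ 0 at hA
    rw [coeff_mul_monomial', mul_one] at hA
    have hCA : C ≤ A := by
      by_contra h
      exact hA (if_neg h)
    rw [if_pos hCA] at hA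
    obtain ⟨D, hD, hDf⟩ := coeff_rename_ne_zero _ _ _ hA
    rw [← tsub_add_cancel_of_le hCA, ← hD, map_add, map_add]
    gcongr
    exact incMonomialOrder_mapDomain_le hπ
      ((incMonomialOrder N k).le_degree (mem_support_iff.2 hDf))
  · change coeff _ (rename (incX π) f.1 * monomial C 1) = _
    rw [coeff_mul_monomial, mul_one, coeff_rename_mapDomain _ (incX_injective hπ)]
    rfl

lemma exists_mem_orbitIdeal_of_mem_span {ι : Type*} {F : Finset (matchingMonoidAlgebra R N k)}
    {f : ι → matchingMonoidAlgebra R N k} {s : Set ι} (hf : ∀ i ∈ s, f i ∈ F)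
    {B : XIdxM N k →₀ ℕ}
    (hB : ∀ i ∈ s,
      IncDvd ((incMonomialOrder N k).degree (f i : MvPolynomial (XIdxM N k) R)) B) {r : R}
    (hr : r ∈ Ideal.span ((fun i => (incMonomialOrder N k).leadingCoeff
      (f i : MvPolynomial (XIdxM N k) R)) '' s)) :
    ∃ h ∈ orbitIdeal F, (∀ A, coeff A (h : MvPolynomial (XIdxM N k) R) ≠ 0 →
        (incMonomialOrder N k).toSyn A ≤ (incMonomialOrder N k).toSyn B) ∧
      coeff B (h : MvPolynomial (XIdxM N k) R) = r := by
  induction hr using Submodule.span_induction with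
  | mem r hr =>
    obtain ⟨i, hi, rfl⟩ := hr
    exact exists_mem_orbitIdeal_of_incDvd (hf i hi) (hB i hi)
  | zero => exact ⟨0, zero_mem _, fun A hA => absurd (coeff_zero A) hA, coeff_zero B⟩
  | add r₁ r₂ _ _ ih₁ ih₂ =>
    obtain ⟨h₁, hm₁, hle₁, rfl⟩ := ih₁
    obtain ⟨h₂, hm₂, hle₂, rfl⟩ := ih₂
    refine ⟨h₁ + h₂, add_mem hm₁ hm₂, fun A hA => ?_, coeff_add _ _ _⟩
    by_cases h : coeff A h₁.1 = 0
    · exact hle₂ A fun h' => hA ((coeff_add _ _ _).trans (by rw [h, h', add_zero]))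
    · exact hle₁ A h
  | smul c r _ ih =>
    obtain ⟨h, hm, hle, rfl⟩ := ih
    refine ⟨c • h, Submodule.smul_of_tower_mem _ c hm, fun A hA => hle A fun h' => hA ?_,
      coeff_smul _ _ _⟩
    exact (coeff_smul _ _ _).trans (by rw [h', smul_zero])

lemma exists_lt_mem_span_image {R : Type*} [CommRing R] [IsNoetherianRing R] (c : ℕ → R) :
    ∃ n, c n ∈ Ideal.span (c '' Set.Iio n) := by
  obtain ⟨n, hn⟩ := monotone_stabilizes_iff_noetherian.2 ‹IsNoetherianRing R›
    ⟨fun n => Ideal.span (c '' Set.Iio n), fun m n hmn =>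
      Ideal.span_mono (Set.image_mono (Set.Iio_subset_Iio hmn))⟩
  refine ⟨n, ?_⟩
  have h : Ideal.span (c '' Set.Iio n) = Ideal.span (c '' Set.Iio (n + 1)) :=
    hn (n + 1) n.le_succ
  rw [h]
  exact Ideal.subset_span ⟨n, n.lt_succ_self, rfl⟩

theorem exists_eq_orbitIdeal [IsNoetherianRing R] (I : Ideal (matchingMonoidAlgebra R N k))
    (hI : ∀ F : Finset (matchingMonoidAlgebra R N k),
      (↑F : Set (matchingMonoidAlgebra R N k)) ⊆ I → orbitIdeal F ≤ I) :
    ∃ F : Finset (matchingMonoidAlgebra R N k),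
      (↑F : Set (matchingMonoidAlgebra R N k)) ⊆ I ∧ I = orbitIdeal F := by
  classical
  by_contra! hne
  let mo := incMonomialOrder N k
  have hmin : ∀ F : Finset (matchingMonoidAlgebra R N k), ∃ x : matchingMonoidAlgebra R N k,
      (↑F : Set (matchingMonoidAlgebra R N k)) ⊆ I → x ∈ I ∧ x ∉ orbitIdeal F ∧
        ∀ y ∈ I, y ∉ orbitIdeal F → mo.toSyn (mo.degree x.1) ≤ mo.toSyn (mo.degree y.1) := by
    intro F
    by_cases hF : (↑F : Set (matchingMonoidAlgebra R N k)) ⊆ I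
    · obtain ⟨x, hxI, hxF⟩ := SetLike.not_le_iff_exists.1
        fun h => hne F hF (le_antisymm h (hI F hF))
      obtain ⟨y, ⟨hyI, hyF⟩, hy⟩ := (InvImage.wf
        (fun z : matchingMonoidAlgebra R N k => mo.toSyn (mo.degree z.1)) wellFounded_lt).has_min
        {z | z ∈ I ∧ z ∉ orbitIdeal F} ⟨x, hxI, hxF⟩
      exact ⟨y, fun _ => ⟨hyI, hyF, fun z hzI hzF => not_lt.1 (hy z ⟨hzI, hzF⟩)⟩⟩
    · exact ⟨0, fun h => absurd h hF⟩
  choose c hc using hmin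
  obtain ⟨G, hG₀, hG⟩ : ∃ G : ℕ → Finset (matchingMonoidAlgebra R N k),
      G 0 = ∅ ∧ ∀ n, G (n + 1) = insert (c (G n)) (G n) :=
    ⟨fun n => Nat.rec ∅ (fun _ F => insert (c F) F) n, rfl, fun _ => rfl⟩
  have hGI : ∀ n : ℕ, (↑(G n) : Set (matchingMonoidAlgebra R N k)) ⊆ I := by
    intro n
    induction n with
    | zero => simp [hG₀]
    | succ n ih =>
      intro x hx
      rw [hG] at hx
      rcases Finset.mem_insert.1 (Finset.mem_coe.1 hx) with rfl | hx
      · exact (hc _ ih).1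
      · exact ih hx
  have hGmono : Monotone G := monotone_nat_of_le_succ fun n =>
    hG n ▸ Finset.subset_insert _ _
  have hcG : ∀ {m n}, m < n → c (G m) ∈ G n := fun {m n} h =>
    hGmono (Nat.succ_le_of_lt h) (hG m ▸ Finset.mem_insert_self _ _)
  let f : ℕ → matchingMonoidAlgebra R N k := fun n => c (G n)
  have hgood : ∀ n, GoodTupleF N k (mo.degree (f n).1) := fun n => by
    refine (f n).2 _ (mo.coeff_degree_ne_zero_iff.2 fun h => (hc _ (hGI n)).2.1 ?_)
    rw [show c (G n) = 0 from Subtype.ext h]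
    exact zero_mem _
  obtain ⟨g, hg⟩ := goodTuples_partiallyWellOrderedOn.exists_monotone_subseq hgood
  obtain ⟨n, hn⟩ := exists_lt_mem_span_image fun i => mo.leadingCoeff (f (g i)).1
  obtain ⟨h, hh, hle, hcoeff⟩ := exists_mem_orbitIdeal_of_mem_span (F := G (g n))
    (f := fun i => f (g i)) (fun i hi => hcG (g.strictMono hi))
    (fun i hi => hg i n (le_of_lt hi)) hn
  obtain ⟨hfI, hfG, hfmin⟩ := hc _ (hGI (g n))
  have hdG : f (g n) - h ∉ orbitIdeal (G (g n)) := fun hd =>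
    hfG (sub_add_cancel (c (G (g n))) h ▸ add_mem hd hh)
  have hdeg := hfmin _ (sub_mem hfI (hI _ (hGI (g n)) hh)) hdG
  have hne : coeff (mo.degree (f (g n) - h).1) (f (g n) - h).1 ≠ 0 :=
    mo.coeff_degree_ne_zero_iff.2 fun h0 => hdG (by
      rw [show f (g n) - h = 0 from Subtype.ext h0]
      exact zero_mem _)
  have hdeg' : mo.toSyn (mo.degree (f (g n) - h).1) ≤ mo.toSyn (mo.degree (f (g n)).1) := by
    by_cases h0 : coeff (mo.degree (f (g n) - h).1) h.1 = 0
    · refine mo.le_degree (mem_support_iff.2 fun h1 => hne ?_)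
      exact (coeff_sub _ _ _ _).trans (by rw [h0, h1, sub_zero])
    · exact hle _ h0
  have heq := mo.toSyn.injective (le_antisymm hdeg' hdeg)
  rw [heq] at hne
  exact hne ((coeff_sub _ _ _ _).trans (sub_eq_zero.2 hcoeff.symm))

end MatchingMonoidAlgebra

/-- The matching monoid algebra, i.e. the `R`-linear span `S` of the monomials `x^A` over
all good tuples `A`, is an `Inc(ℕ)`-stable `R`-subalgebra of `R[X]` and is
`Inc(ℕ)`-Noetherian: every `Inc(ℕ)`-stable ideal of `S` is generated by the union of
finitely many `Inc(ℕ)`-orbits of its elements. -/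
theorem matchingMonoidAlgebra_noetherian
    (R : Type) [CommRing R] [IsNoetherianRing R]
    (N : ℕ) (hN : 1 ≤ N) (k : Fin N → ℕ) (hk : ∀ p, 1 ≤ k p) :
    ∃ S : Subalgebra R (MvPolynomial (XIdxM N k) R),
      (S : Set (MvPolynomial (XIdxM N k) R)) =
        (Submodule.span R {f : MvPolynomial (XIdxM N k) R |
          ∃ A : XIdxM N k →₀ ℕ, GoodTupleF N k A ∧ f = monomial A 1} :
            Set (MvPolynomial (XIdxM N k) R)) ∧
      (∀ (π : ℕ → ℕ), StrictMono π → ∀ f ∈ S, rename (incX π) f ∈ S) ∧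
      ∀ I : Ideal S,
        (∀ (π : ℕ → ℕ), StrictMono π → ∀ x ∈ I, ∀ y : S,
            (y : MvPolynomial (XIdxM N k) R) =
              rename (incX π) (x : MvPolynomial (XIdxM N k) R) → y ∈ I) →
        ∃ F : Finset S, (↑F : Set S) ⊆ (I : Set S) ∧
          I = Ideal.span {g : S | ∃ f ∈ F, ∃ π : ℕ → ℕ, StrictMono π ∧
            (g : MvPolynomial (XIdxM N k) R) =
              rename (incX π) (f : MvPolynomial (XIdxM N k) R)} := by
  refine ⟨matchingMonoidAlgebra R N k, coe_matchingMonoidAlgebra,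
    fun π hπ f hf => rename_mem_matchingMonoidAlgebra hπ hf, fun I hI => ?_⟩
  refine exists_eq_orbitIdeal I fun F hF => Ideal.span_le.2 ?_
  rintro g ⟨f, hf, π, hπ, hg⟩
  exact hI π hπ f (hF hf) g hg
end

section
/- Fix k ≥ 1. For every t ∈ ℕ, the partially ordered set (𝓜_t, ≼) of elements of 𝓜 with exactly t bad columns is a well-partial-order. -/
/-- An element of the set 𝓜: a natural number `len` (the length), a matrix `A` with `k+1`
rows and `len` columns of natural numbers, and a degree `d`, such that every column sum of
`A` equals `d` and each of the first `k` row sums of `A` is at most `d`. -/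
structure MatM (k : ℕ) where
  len : ℕ
  A : Fin (k + 1) → Fin len → ℕ
  d : ℕ
  colsum : ∀ j, ∑ i, A i j = d
  rowsum : ∀ i : Fin k, ∑ j, A i.castSucc j ≤ d

/-- The partial order ≼ on 𝓜: `X ≼ Y` iff `d_X ≤ d_Y` and there is a strictly increasing
map `ρ` of column indices with `ρX ≤ Y` entrywise, where `ρX` has column `X_{·,j}` at
position `ρ(j)` and the trivial column `(0,…,0,d_X)ᵀ` at positions outside the image of `ρ`. -/
def MatM.pre {k : ℕ} (X Y : MatM k) : Prop :=
  X.d ≤ Y.d ∧ ∃ ρ : Fin X.len → Fin Y.len, StrictMono ρ ∧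
    (∀ i j, X.A i j ≤ Y.A i (ρ j)) ∧
    (∀ j : Fin Y.len, (∀ j', ρ j' ≠ j) → X.d ≤ Y.A (Fin.last k) j)

/-- The number of bad columns of `X`: the `j`-th column is bad if `2·X_{k,j} ≤ d_X`. -/
def MatM.badCard {k : ℕ} (X : MatM k) : ℕ :=
  (Finset.univ.filter fun j : Fin X.len => 2 * X.A (Fin.last k) j ≤ X.d).card

/-- A relation-respecting sublist embedding of tabulated words is a strictly increasing map of
positions that respects the relation letterwise. -/
theorem exists_strictMono_of_sublistForall₂_ofFn {α β : Type*} {r : α → β → Prop} {m n : ℕ}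
    {u : Fin m → α} {v : Fin n → β}
    (h : List.SublistForall₂ r (List.ofFn u) (List.ofFn v)) :
    ∃ ρ : Fin m → Fin n, StrictMono ρ ∧ ∀ j, r (u j) (v (ρ j)) := by
  obtain ⟨l, hl, hs⟩ := List.sublistForall₂_iff.1 h
  obtain ⟨e, he⟩ := List.sublist_iff_exists_fin_orderEmbedding_get_eq.1 hs
  obtain ⟨hlen, hget⟩ := List.forall₂_iff_get.1 hl
  rw [List.length_ofFn] at hlen
  refine ⟨fun j => Fin.cast List.length_ofFn (e (Fin.cast hlen j)), ?_, ?_⟩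
  · intro a b hab
    exact e.strictMono (show Fin.cast hlen a < Fin.cast hlen b from hab)
  · intro j
    have h₁ := hget j (by simp) (by simp [← hlen])
    have h₂ := he (Fin.cast hlen j)
    rw [List.get_ofFn] at h₁ h₂
    change _ = v _ at h₂
    rw [← h₂]
    exact h₁

/-- An injection that maps a finite set `s` into a set `t` of at most the same size reaches
every element of `t`. -/
theorem exists_eq_of_injective_of_card_le {α β : Type*} {ρ : α → β}
    (hρ : Function.Injective ρ) {s : Finset α} {t : Finset β} (hst : ∀ a ∈ s, ρ a ∈ t)
    (hcard : t.card ≤ s.card) {b : β} (hb : b ∈ t) : ∃ a, ρ a = b := by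
  obtain ⟨a, -, ha⟩ := Finset.surj_on_of_inj_on_of_card_le (fun a _ => ρ a) hst
    (fun _ _ _ _ h => hρ h) hcard b hb
  exact ⟨a, ha.symm⟩

namespace MatM

variable {k : ℕ}

/-- The word of columns of `X`, each tagged by whether it is bad. -/
def word (X : MatM k) : List ((Fin (k + 1) → ℕ) × Bool) :=
  List.ofFn fun j => (fun i => X.A i j, decide (2 * X.A (Fin.last k) j ≤ X.d))

/-- The columns of `X` different from `(0,…,0,d)ᵀ`. -/
def nontrivialCols (X : MatM k) : Finset (Fin X.len) :=
  Finset.univ.filter fun j => X.A (Fin.last k) j ≠ X.d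

theorem sum_castSucc_add_last (X : MatM k) (j : Fin X.len) :
    ∑ i : Fin k, X.A i.castSucc j + X.A (Fin.last k) j = X.d := by
  rw [← Fin.sum_univ_castSucc (fun i => X.A i j), X.colsum]

theorem card_nontrivialCols_le (X : MatM k) : X.nontrivialCols.card ≤ k * X.d := by
  calc X.nontrivialCols.card
      = ∑ _j ∈ X.nontrivialCols, 1 := by simp
    _ ≤ ∑ j ∈ X.nontrivialCols, ∑ i : Fin k, X.A i.castSucc j := by
        refine Finset.sum_le_sum fun j hj => ?_
        have h := X.sum_castSucc_add_last j
        have hne : X.A (Fin.last k) j ≠ X.d := (Finset.mem_filter.1 hj).2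
        omega
    _ ≤ ∑ j, ∑ i : Fin k, X.A i.castSucc j :=
        Finset.sum_le_sum_of_subset (Finset.subset_univ _)
    _ = ∑ i : Fin k, ∑ j, X.A i.castSucc j := Finset.sum_comm
    _ ≤ ∑ _i : Fin k, X.d := Finset.sum_le_sum fun i _ => X.rowsum i
    _ = k * X.d := by simp

theorem exists_strictMono_of_word {X Y : MatM k}
    (h : List.SublistForall₂ (· ≤ ·) X.word Y.word) :
    ∃ ρ : Fin X.len → Fin Y.len, StrictMono ρ ∧ (∀ i j, X.A i j ≤ Y.A i (ρ j)) ∧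
      ∀ j, 2 * X.A (Fin.last k) j ≤ X.d → 2 * Y.A (Fin.last k) (ρ j) ≤ Y.d := by
  obtain ⟨ρ, hρ, hle⟩ := exists_strictMono_of_sublistForall₂_ofFn h
  refine ⟨ρ, hρ, fun i j => (hle j).1 i, fun j hj => ?_⟩
  exact of_decide_eq_true ((hle j).2 (decide_eq_true hj))

/-- If the degree at least doubles, an embedding of tagged words that exhausts the bad columns
is a witness for `pre`. -/
theorem pre_of_two_mul_le {X Y : MatM k} (h : List.SublistForall₂ (· ≤ ·) X.word Y.word)
    (hbad : Y.badCard ≤ X.badCard) (hd : 2 * X.d ≤ Y.d) : X.pre Y := by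
  obtain ⟨ρ, hρ, hA, hb⟩ := exists_strictMono_of_word h
  refine ⟨by omega, ρ, hρ, hA, fun j hj => ?_⟩
  by_contra hlt
  obtain ⟨b, hbj⟩ := exists_eq_of_injective_of_card_le hρ.injective
    (fun a ha => Finset.mem_filter.2 ⟨Finset.mem_univ _, hb a (Finset.mem_filter.1 ha).2⟩) hbad
    (Finset.mem_filter.2 ⟨Finset.mem_univ j, by omega⟩)
  exact hj b hbj

/-- If the degrees agree, an embedding of words that exhausts the nontrivial columns is a
witness for `pre`. -/
theorem pre_of_d_eq {X Y : MatM k} (h : List.SublistForall₂ (· ≤ ·) X.word Y.word)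
    (hd : X.d = Y.d) (hcard : Y.nontrivialCols.card ≤ X.nontrivialCols.card) : X.pre Y := by
  obtain ⟨ρ, hρ, hA, -⟩ := exists_strictMono_of_word h
  refine ⟨hd.le, ρ, hρ, hA, fun j hj => ?_⟩
  by_contra hlt
  have hmaps : ∀ a ∈ X.nontrivialCols, ρ a ∈ Y.nontrivialCols := fun a ha => by
    have hne : X.A (Fin.last k) a ≠ X.d := (Finset.mem_filter.1 ha).2
    refine Finset.mem_filter.2 ⟨Finset.mem_univ _, ?_⟩
    have h₁ := X.sum_castSucc_add_last a
    have h₂ := Y.sum_castSucc_add_last (ρ a)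
    have h₃ : ∑ i : Fin k, X.A i.castSucc a ≤ ∑ i : Fin k, Y.A i.castSucc (ρ a) :=
      Finset.sum_le_sum fun i _ => hA i.castSucc a
    omega
  obtain ⟨b, hbj⟩ := exists_eq_of_injective_of_card_le hρ.injective hmaps hcard
    (Finset.mem_filter.2 ⟨Finset.mem_univ j, by omega⟩)
  exact hj b hbj

theorem exists_monotone_subseq_word (X : ℕ → MatM k) :
    ∃ g : ℕ ↪o ℕ, ∀ m n, m ≤ n →
      List.SublistForall₂ (· ≤ ·) (X (g m)).word (X (g n)).word := by
  have hpwo : (Set.univ : Set ((Fin (k + 1) → ℕ) × Bool)).PartiallyWellOrderedOn (· ≤ ·) :=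
    Set.isPWO_of_wellQuasiOrderedLE _
  have : IsPreorder (List ((Fin (k + 1) → ℕ) × Bool)) (List.SublistForall₂ (· ≤ ·)) := { }
  exact (hpwo.partiallyWellOrderedOn_sublistForall₂ (· ≤ ·)).exists_monotone_subseq
    (f := fun n => (X n).word) fun _ _ _ => Set.mem_univ _

end MatM

/-- For every t ∈ ℕ, (𝓜ₜ, ≼), the set of elements of 𝓜 with exactly t bad columns, is a well-partial-order. -/
theorem matMt_wpo (k : ℕ) (hk : 1 ≤ k) (t : ℕ) (f : ℕ → {X : MatM k // X.badCard = t}) :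
    ∃ i j : ℕ, i < j ∧ MatM.pre (f i).1 (f j).1 := by
  obtain ⟨g, hg⟩ := MatM.exists_monotone_subseq_word fun n => (f n).1
  by_cases hdouble : ∃ n, 0 < n ∧ 2 * (f (g 0)).1.d ≤ (f (g n)).1.d
  · obtain ⟨n, hn, hd⟩ := hdouble
    exact ⟨g 0, g n, g.strictMono hn, MatM.pre_of_two_mul_le (hg 0 n hn.le)
      ((f (g n)).2.trans (f (g 0)).2.symm).le hd⟩
  · push Not at hdouble
    set D := 2 * (f (g 0)).1.d
    have hlt : ∀ n, (f (g (n + 1))).1.d < D + 1 := fun n =>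
      (hdouble (n + 1) n.succ_pos).trans D.lt_succ_self
    have hcard : ∀ n, (f (g (n + 1))).1.nontrivialCols.card < k * D + 1 := fun n =>
      Nat.lt_succ_of_le ((MatM.card_nontrivialCols_le _).trans
        (Nat.mul_le_mul_left k (Nat.le_of_lt_succ (hlt n))))
    obtain ⟨a, b, hab, heq⟩ := Finite.exists_ne_map_eq_of_infinite
      fun n => ((⟨_, hlt n⟩, ⟨_, hcard n⟩) : Fin (D + 1) × Fin (k * D + 1))
    simp only [Prod.mk.injEq, Fin.mk.injEq] at heq
    wlog hlt_ab : a < b generalizing a b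
    · exact this b a hab.symm ⟨heq.1.symm, heq.2.symm⟩ (by omega)
    exact ⟨g (a + 1), g (b + 1), g.strictMono (by omega),
      MatM.pre_of_d_eq (hg _ _ (by omega)) heq.1 heq.2.ge⟩
end
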